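/- Fix n ≥ 2 and consider the dendrite replacement system D_n: a single color, base graph Γ₀ with two distinct vertices joined by one edge S, and replacement graph Γ₁ a star with a central vertex v, boundary vertices ι₁ and τ₁, n−2 further leaf vertices, and n edges labeled 1,…,n, all with initial vertex v, where τ(1)=ι₁, τ(n)=τ₁, and edges 2,…,n−1 end at the distinct leaves. Its symbol space is identified with {1,…,n}^ω (suppressing the common first letter S). Then two distinct sequences α,β are glued (α ∼ β) if and only if there exist a finite word p ∈ {1,…,n}* and distinct letters i ≠ j in {1,…,n} such that {α,β} = {p·i·1·n^ω, p·j·1·n^ω}, i.e. after the common prefix p the two sequences read i and j respectively, then both read 1, and then both read n forever. -/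

import Mathlib

/-!
Formalization of edge replacement systems, their limit-space gluing relation,
and the gluing automaton, following Belk–Forrest and the paper
"Rationality of the gluing of edge replacement systems".
-/

namespace ERSPaper

/-- The five adjacency-type symbols `in`, `out`, `lp`, `db⁺`, `db⁻`. -/
inductive EType : Type
  | inn : EType
  | out : EType
  | lp : EType
  | dbp : EType
  | dbm : EType
  deriving DecidableEq

/-- An edge replacement system satisfying the loop-color assumption.
`V z` / `E z` are the vertices/edges of the base graph (`z = none`) or of the
replacement graph `Γ c` (`z = some c`).  For loop colors the two boundary
vertices coincide (the single boundary vertex `λ_c`); for non-loop colors they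
are distinct.  The field `loop_iff` is the loop-color assumption: an edge is a
loop if and only if its color is a loop color. -/
structure ERS : Type 1 where
  Col : Type
  [colFintype : Fintype Col]
  [colDecEq : DecidableEq Col]
  V : Option Col → Type
  E : Option Col → Type
  [vFintype : ∀ z, Fintype (V z)]
  [eFintype : ∀ z, Fintype (E z)]
  [vDecEq : ∀ z, DecidableEq (V z)]
  ini : ∀ z, E z → V z
  fin : ∀ z, E z → V z
  col : ∀ z, E z → Col
  loopCol : Col → Prop
  bIni : ∀ c : Col, V (some c)
  bFin : ∀ c : Col, V (some c)
  bd_eq_iff : ∀ c : Col, (bIni c = bFin c ↔ loopCol c)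
  loop_iff : ∀ z (e : E z), (ini z e = fin z e ↔ loopCol (col z e))

attribute [instance] ERS.colFintype ERS.colDecEq ERS.vFintype ERS.eFintype ERS.vDecEq

namespace ERS

/-- The alphabet `Σ`: the disjoint union of the edge sets of the base graph and
of all the replacement graphs. -/
def Alph (R : ERS) : Type := Σ z : Option R.Col, R.E z

/-- Membership in the symbol space `Ω_R`: infinite directed walks on the color
graph starting at `q(0)`, i.e. `x₀` is an edge of the base graph and `x_{l+1}`
is an edge of `Γ_{c(x_l)}`. -/
def IsWalk (R : ERS) (x : ℕ → R.Alph) : Prop :=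
  (x 0).1 = none ∧ ∀ l : ℕ, (x (l + 1)).1 = some (R.col (x l).1 (x l).2)

/-- The finite word `x₀ … x_m` belongs to `E_R`. -/
def IsWalkUpTo (R : ERS) (x : ℕ → R.Alph) (m : ℕ) : Prop :=
  (x 0).1 = none ∧ ∀ l : ℕ, l < m → (x (l + 1)).1 = some (R.col (x l).1 (x l).2)

theorem IsWalk.upTo {R : ERS} {x : ℕ → R.Alph} (hx : R.IsWalk x) (m : ℕ) :
    R.IsWalkUpTo x m :=
  ⟨hx.1, fun l _ => hx.2 l⟩

end ERS

/-- A finite graph whose edges are colored by the colors of `R`. -/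
structure GraphData (R : ERS) : Type 1 where
  V : Type
  E : Type
  ι : E → V
  τ : E → V
  col : E → R.Col

/-- An edge is incident on a vertex. -/
def GraphData.IncidentOn {R : ERS} (G : GraphData R) (e : G.E) (v : G.V) : Prop :=
  G.ι e = v ∨ G.τ e = v

/-- Two edges are incident on a common vertex. -/
def GraphData.Adjacent {R : ERS} (G : GraphData R) (e f : G.E) : Prop :=
  ∃ v : G.V, G.IncidentOn e v ∧ G.IncidentOn f v

namespace ERS

/-- When expanding the edge `e`, a vertex `v` of the replacement graph
`Γ_{c(e)}` is attached: boundary vertices go to the endpoints of `e`,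
interior vertices give fresh vertices. -/
def attach (R : ERS) (G : GraphData R) (e : G.E) (v : R.V (some (G.col e))) :
    G.V ⊕ (Σ e : G.E,
      {v : R.V (some (G.col e)) // v ≠ R.bIni (G.col e) ∧ v ≠ R.bFin (G.col e)}) :=
  if h1 : v = R.bIni (G.col e) then Sum.inl (G.ι e)
  else if h2 : v = R.bFin (G.col e) then Sum.inl (G.τ e)
  else Sum.inr ⟨e, v, h1, h2⟩

/-- The simultaneous expansion of every edge of `G`. -/
def expandG (R : ERS) (G : GraphData R) : GraphData R where
  V := G.V ⊕ (Σ e : G.E,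
    {v : R.V (some (G.col e)) // v ≠ R.bIni (G.col e) ∧ v ≠ R.bFin (G.col e)})
  E := Σ e : G.E, R.E (some (G.col e))
  ι := fun p => R.attach G p.1 (R.ini (some (G.col p.1)) p.2)
  τ := fun p => R.attach G p.1 (R.fin (some (G.col p.1)) p.2)
  col := fun p => R.col (some (G.col p.1)) p.2

/-- The base graph, as graph data. -/
def base (R : ERS) : GraphData R :=
  ⟨R.V none, R.E none, R.ini none, R.fin none, R.col none⟩

/-- The full expansion sequence `E_m`. -/
def fullExp (R : ERS) : ℕ → GraphData R
  | 0 => R.base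
  | m + 1 => R.expandG (R.fullExp m)

theorem col_cast (R : ERS) (p : R.Alph) (z : Option R.Col) (h : p.1 = z) :
    R.col z (cast (congrArg R.E h) p.2) = R.col p.1 p.2 := by
  rcases p with ⟨w, e⟩
  cases h
  rfl

/-- The edge of the full expansion `E_m` labeled by the word `x₀ … x_m`,
together with the fact that its color is the color of its last letter. -/
def wordEdge (R : ERS) (x : ℕ → R.Alph) :
    (m : ℕ) → R.IsWalkUpTo x m →
      {e : (R.fullExp m).E // (R.fullExp m).col e = R.col (x m).1 (x m).2}
  | 0, hx => ⟨cast (congrArg R.E hx.1) (x 0).2, R.col_cast (x 0) none hx.1⟩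
  | m + 1, hx =>
    let prev := R.wordEdge x m ⟨hx.1, fun l hl => hx.2 l (Nat.lt_succ_of_lt hl)⟩
    let h : (x (m + 1)).1 = some ((R.fullExp m).col prev.1) :=
      (hx.2 m (Nat.lt_succ_self m)).trans (congrArg some prev.2.symm)
    ⟨⟨prev.1, cast (congrArg R.E h) (x (m + 1)).2⟩, R.col_cast (x (m + 1)) _ h⟩

/-- The gluing relation: two elements of `Ω_R` are glued when, for every large
enough `n`, their length-`(n+1)` prefixes are incident on a common vertex of
the full expansion `E_n`. -/
def Glued (R : ERS) (x y : ℕ → R.Alph) (hx : R.IsWalk x) (hy : R.IsWalk y) : Prop :=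
  ∃ N : ℕ, ∀ n : ℕ, N ≤ n →
    (R.fullExp n).Adjacent (R.wordEdge x n (hx.upTo n)).1 (R.wordEdge y n (hy.upTo n)).1

/-- The expanding condition on a replacement system (formulated after the
identification of the boundary vertices for loop colors). -/
structure Expanding (R : ERS) : Prop where
  no_isolated : ∀ z (v : R.V z), ∃ e : R.E z, R.ini z e = v ∨ R.fin z e = v
  no_bd_edge : ∀ c : R.Col, ¬ R.loopCol c → ∀ e : R.E (some c),
    ¬ ((R.ini (some c) e = R.bIni c ∧ R.fin (some c) e = R.bFin c) ∨
       (R.ini (some c) e = R.bFin c ∧ R.fin (some c) e = R.bIni c))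
  two_edges : ∀ c : R.Col, 2 ≤ Fintype.card (R.E (some c))
  interior : ∀ c : R.Col, ∃ v : R.V (some c), v ≠ R.bIni c ∧ v ≠ R.bFin c

end ERS

/-- `EndAt ι τ v α` : the edge with initial vertex `ι` and terminal vertex `τ`
is incident on `v`, in the fashion recorded by `α`: incoming (`in`), outgoing
(`out`) or a loop (`lp`). -/
inductive EndAt {V : Type} : V → V → V → EType → Prop
  | inn {i v : V} : i ≠ v → EndAt i v v .inn
  | out {t v : V} : v ≠ t → EndAt v t v .out
  | lp {v : V} : EndAt v v v .lp

/-- Two non-loop edges (given by their endpoints) are parallel. -/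
def Parallel {V : Type} (ia ta ib tb : V) : Prop :=
  ia ≠ ta ∧ ((ia = ib ∧ ta = tb) ∨ (ia = tb ∧ ta = ib))

/-- The Type 1 adjacency-type rule for two distinct adjacent edges, given by
their endpoints: parallel non-loops give the `db` types (same or opposite
orientation), and otherwise the unique common vertex `v` determines the types
via `EndAt`. -/
inductive AdjType {V : Type} : V → V → V → V → EType → EType → Prop
  | dbSame {u v : V} : u ≠ v → AdjType u v u v .dbp .dbp
  | dbOpp {u v : V} : u ≠ v → AdjType u v v u .dbp .dbm
  | single {ia ta ib tb v : V} {α β : EType} :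
      ¬ Parallel ia ta ib tb → EndAt ia ta v α → EndAt ib tb v β →
      AdjType ia ta ib tb α β

/-- The states of the gluing automaton `Gl_R`. -/
inductive GlState (R : ERS) : Type
  | q0 : Option R.Col → GlState R
  | q1 : R.Col → EType → R.Col → EType → GlState R

/-- Membership in `Q₀`. -/
def GlState.inQ0 {R : ERS} : GlState R → Prop
  | .q0 _ => True
  | _ => False

/-- Membership in `Q₁`. -/
def GlState.inQ1 {R : ERS} : GlState R → Prop
  | .q1 _ _ _ _ => True
  | _ => False

/-- The defining conditions for states of `Q₁`: `γ ≠ db⁻` and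
(`δ ∈ {db⁺, db⁻}` iff `γ = db⁺`). -/
def GlState.Valid {R : ERS} : GlState R → Prop
  | .q0 _ => True
  | .q1 _ γ _ δ => γ ≠ .dbm ∧ ((δ = .dbp ∨ δ = .dbm) ↔ γ = .dbp)

/-- The tracked boundary vertex of `Γ_c` for a non-`db` symbol:
`τ_c` for `in`, `ι_c` for `out`, and `λ_c` (the identified boundary vertex)
for `lp`. -/
def trackedV (R : ERS) (c : R.Col) : EType → Set (R.V (some c))
  | .inn => {R.bFin c}
  | .out => {R.bIni c}
  | .lp => {R.bIni c}
  | _ => ∅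

/-- The pairs of tracked vertices of a state `q₁(i,γ;j,δ)`. -/
inductive TrackedPair (R : ERS) (i j : R.Col) :
    EType → EType → R.V (some i) → R.V (some j) → Prop
  | nondb {γ δ : EType} {u : R.V (some i)} {w : R.V (some j)} :
      u ∈ trackedV R i γ → w ∈ trackedV R j δ → TrackedPair R i j γ δ u w
  | dbppIni : TrackedPair R i j .dbp .dbp (R.bIni i) (R.bIni j)
  | dbppFin : TrackedPair R i j .dbp .dbp (R.bFin i) (R.bFin j)
  | dbpmIni : TrackedPair R i j .dbp .dbm (R.bIni i) (R.bFin j)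
  | dbpmFin : TrackedPair R i j .dbp .dbm (R.bFin i) (R.bIni j)

/-- The transitions of the gluing automaton `Gl_R`. -/
inductive GlTrans (R : ERS) : GlState R → R.Alph × R.Alph → GlState R → Prop
  | type0 (z : Option R.Col) (e : R.E z) :
      GlTrans R (.q0 z) (⟨z, e⟩, ⟨z, e⟩) (.q0 (some (R.col z e)))
  | type1 (z : Option R.Col) (a b : R.E z) (hab : a ≠ b) {α β : EType}
      (h : AdjType (R.ini z a) (R.fin z a) (R.ini z b) (R.fin z b) α β) :
      GlTrans R (.q0 z) (⟨z, a⟩, ⟨z, b⟩) (.q1 (R.col z a) α (R.col z b) β)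
  | type2 (i j : R.Col) (γ δ : EType) (a : R.E (some i)) (b : R.E (some j))
      {u : R.V (some i)} {w : R.V (some j)}
      (hp : TrackedPair R i j γ δ u w) {α β : EType}
      (ha : EndAt (R.ini (some i) a) (R.fin (some i) a) u α)
      (hb : EndAt (R.ini (some j) b) (R.fin (some j) b) w β) :
      GlTrans R (.q1 i γ j δ) (⟨some i, a⟩, ⟨some j, b⟩)
        (.q1 (R.col (some i) a) α (R.col (some j) b) β)

/-- Infinite runs of `Gl_R` from the initial state `q₀(0)`. -/
def GlRun (R : ERS) (w : ℕ → R.Alph × R.Alph) (q : ℕ → GlState R) : Prop :=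
  q 0 = .q0 none ∧ ∀ l : ℕ, GlTrans R (q l) (w l) (q (l + 1))

/-- `Gl_R` recognizes the infinite sequence `w`. -/
def GlAccepts (R : ERS) (w : ℕ → R.Alph × R.Alph) : Prop :=
  ∃ q : ℕ → GlState R, GlRun R w q

/-- Finite runs of `Gl_R` processing the letters `w 0, …, w m`. -/
def GlRunFin (R : ERS) (w : ℕ → R.Alph × R.Alph) (m : ℕ) (q : ℕ → GlState R) : Prop :=
  q 0 = .q0 none ∧ ∀ l : ℕ, l ≤ m → GlTrans R (q l) (w l) (q (l + 1))

/-- `Gl_R` recognizes the finite word `w 0, …, w m`. -/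
def GlAcceptsFin (R : ERS) (w : ℕ → R.Alph × R.Alph) (m : ℕ) : Prop :=
  ∃ q : ℕ → GlState R, GlRunFin R w m q

/-- The transitions of the full sub-automaton `T_R` induced by `Q₀`. -/
def TTrans (R : ERS) (s : GlState R) (p : R.Alph × R.Alph) (t : GlState R) : Prop :=
  GlTrans R s p t ∧ s.inQ0 ∧ t.inQ0

/-- Finite runs of `T_R` processing the letters `w 0, …, w m`. -/
def TRunFin (R : ERS) (w : ℕ → R.Alph × R.Alph) (m : ℕ) (q : ℕ → GlState R) : Prop :=
  q 0 = .q0 none ∧ ∀ l : ℕ, l ≤ m → TTrans R (q l) (w l) (q (l + 1))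

/-- `T_R` recognizes the finite word `w 0, …, w m`. -/
def TAcceptsFin (R : ERS) (w : ℕ → R.Alph × R.Alph) (m : ℕ) : Prop :=
  ∃ q : ℕ → GlState R, TRunFin R w m q

end ERSPaper

namespace ERSPaper

/-- The dendrite replacement system `D_n` (for `n ≥ 2`): one color, base graph
a single edge `S` between two distinct vertices, and replacement graph a star
with central vertex `v` (encoded as `none`), `n` edges `1, …, n` (encoded by
`Fin n`, all with initial vertex `v`), edge `i` ending at the leaf `some i`;
the boundary vertices are `ι₁ = τ(1) = some 0` and `τ₁ = τ(n) = some (n-1)`. -/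
def dendriteERS (n : ℕ) (hn : 2 ≤ n) : ERS where
  Col := PUnit
  V := fun z => match z with | none => Bool | some _ => Option (Fin n)
  E := fun z => match z with | none => PUnit | some _ => Fin n
  vFintype := fun z => match z with
    | none => inferInstanceAs (Fintype Bool)
    | some _ => inferInstanceAs (Fintype (Option (Fin n)))
  eFintype := fun z => match z with
    | none => inferInstanceAs (Fintype PUnit)
    | some _ => inferInstanceAs (Fintype (Fin n))
  vDecEq := fun z => match z with
    | none => inferInstanceAs (DecidableEq Bool)
    | some _ => inferInstanceAs (DecidableEq (Option (Fin n)))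
  ini := fun z => match z with
    | none => fun _ => false
    | some _ => fun _ => none
  fin := fun z => match z with
    | none => fun _ => true
    | some _ => fun i => some i
  col := fun _ _ => PUnit.unit
  loopCol := fun _ => False
  bIni := fun _ => some (⟨0, by omega⟩ : Fin n)
  bFin := fun _ => some (⟨n - 1, by omega⟩ : Fin n)
  bd_eq_iff := fun _ => by
    show some (⟨0, by omega⟩ : Fin n) = some (⟨n - 1, by omega⟩ : Fin n) ↔ False
    simp only [Option.some.injEq, Fin.mk.injEq, iff_false]
    omega
  loop_iff := by
    intro z e
    cases z with
    | none =>
      show false = true ↔ False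
      simp
    | some c =>
      show none = some e ↔ False
      simp

/-- The `Fin n` value of a letter of the alphabet of `D_n` coming from the
replacement graph (letters of the base graph are sent to a junk value). -/
def dendriteVal (n : ℕ) (hn : 2 ≤ n) : (dendriteERS n hn).Alph → Fin n := fun a =>
  match a with
  | ⟨none, _⟩ => ⟨0, by omega⟩
  | ⟨some _, i⟩ => i

section Helpers

variable {n : ℕ} {hn : 2 ≤ n}

/-- Simplified names for the vertices of the expansion of `G`. -/
def encV (G : GraphData (dendriteERS n hn)) :
    ((dendriteERS n hn).expandG G).V → G.V ⊕ (G.E × Option (Fin n))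
  | Sum.inl v => Sum.inl v
  | Sum.inr p => Sum.inr (p.1, p.2.1)

theorem encV_inj (G : GraphData (dendriteERS n hn)) : Function.Injective (encV G) := by
  rintro (v | ⟨e, v, h⟩) (w | ⟨f, w, k⟩) hvw
  · simp only [encV, Sum.inl.injEq] at hvw
    rw [hvw]
  · simp [encV] at hvw
  · simp [encV] at hvw
  · obtain ⟨h1, h2⟩ := Prod.mk.inj (Sum.inr.inj hvw)
    change e = f at h1
    subst h1
    have h3 : v = w := h2
    subst h3
    rfl

/-- A child edge of the expansion. -/
def child (G : GraphData (dendriteERS n hn)) (e : G.E) (i : Fin n) :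
    ((dendriteERS n hn).expandG G).E := ⟨e, i⟩

theorem encV_ini (G : GraphData (dendriteERS n hn)) (e : G.E) (i : Fin n) :
    encV G (((dendriteERS n hn).expandG G).ι (child G e i)) = Sum.inr (e, none) := by
  change encV G ((dendriteERS n hn).attach G e (none : Option (Fin n))) = _
  unfold ERS.attach
  rw [dif_neg, dif_neg]
  · rfl
  · exact fun h => Option.noConfusion (α := Fin n) rfl (heq_of_eq h)
  · exact fun h => Option.noConfusion (α := Fin n) rfl (heq_of_eq h)

theorem encV_fin (G : GraphData (dendriteERS n hn)) (e : G.E) (i : Fin n) :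
    encV G (((dendriteERS n hn).expandG G).τ (child G e i)) =
      if i = ⟨0, by omega⟩ then Sum.inl (G.ι e)
      else if i = ⟨n - 1, by omega⟩ then Sum.inl (G.τ e) else Sum.inr (e, some i) := by
  change encV G ((dendriteERS n hn).attach G e (some i : Option (Fin n))) = _
  unfold ERS.attach
  by_cases h1 : i = ⟨0, by omega⟩
  · rw [if_pos h1, dif_pos]
    · rfl
    · exact congrArg some h1
  · rw [if_neg h1, dif_neg]
    swap
    · exact fun h => h1 (Option.some.inj (α := Fin n) h)
    by_cases h2 : i = ⟨n - 1, by omega⟩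
    · rw [if_pos h2, dif_pos]
      · rfl
      · exact congrArg some h2
    · rw [if_neg h2, dif_neg]
      · rfl
      · exact fun h => h2 (Option.some.inj (α := Fin n) h)

def NoLoop (G : GraphData (dendriteERS n hn)) : Prop := ∀ e, G.ι e ≠ G.τ e

def StA (G : GraphData (dendriteERS n hn)) (e f : G.E) : Prop :=
  G.ι e = G.ι f ∧ G.τ e ≠ G.τ f ∧ G.ι e ≠ G.τ f ∧ G.τ e ≠ G.ι f

def StB (G : GraphData (dendriteERS n hn)) (e f : G.E) : Prop :=
  G.τ e = G.τ f ∧ G.ι e ≠ G.ι f ∧ G.ι e ≠ G.τ f ∧ G.τ e ≠ G.ι f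

def StN (G : GraphData (dendriteERS n hn)) (e f : G.E) : Prop :=
  G.τ e ≠ G.τ f ∧ G.ι e ≠ G.ι f ∧ G.ι e ≠ G.τ f ∧ G.τ e ≠ G.ι f

theorem StN.not_adj {G : GraphData (dendriteERS n hn)} {e f : G.E} (h : StN G e f) :
    ¬ G.Adjacent e f := by
  obtain ⟨h1, h2, h3, h4⟩ := h
  rintro ⟨v, h5 | h5, h6 | h6⟩ <;> simp_all

theorem noLoop_child (G : GraphData (dendriteERS n hn)) :
    NoLoop ((dendriteERS n hn).expandG G) := by
  have aux : ∀ (e : G.E) (i : Fin n), ((dendriteERS n hn).expandG G).ι (child G e i) ≠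
      ((dendriteERS n hn).expandG G).τ (child G e i) := by
    intro e i h
    have h := congrArg (encV G) h
    rw [encV_ini, encV_fin] at h
    split_ifs at h <;> simp_all
  exact fun e => aux e.1 e.2

theorem stA_child (G : GraphData (dendriteERS n hn)) (hG : NoLoop G) (e : G.E) (i j : Fin n)
    (hij : i ≠ j) : StA _ (child G e i) (child G e j) := by
  have := hG e
  have h0 : n ≠ 0 := by omega
  have h1 : 0 ≠ n - 1 := by omega
  unfold StA
  simp only [ne_eq, ← (encV_inj G).eq_iff, encV_ini, encV_fin]
  refine ⟨trivial, ?_, ?_, ?_⟩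
  all_goals split_ifs <;> simp_all [eq_comm]

theorem stA_step (G : GraphData (dendriteERS n hn)) (e f : G.E) (i j : Fin n)
    (h : StA G e f) :
    (i = ⟨0, by omega⟩ ∧ j = ⟨0, by omega⟩ ∧ StB _ (child G e i) (child G f j)) ∨
    (¬ (i = ⟨0, by omega⟩ ∧ j = ⟨0, by omega⟩) ∧ StN _ (child G e i) (child G f j)) := by
  have hef : e ≠ f := fun h' => h.2.1 (by rw [h'])
  obtain ⟨h1, h2, h3, h4⟩ := h
  unfold StB StN
  simp only [ne_eq, ← (encV_inj G).eq_iff, encV_ini, encV_fin]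
  split_ifs <;> simp_all

theorem stB_step (G : GraphData (dendriteERS n hn)) (e f : G.E) (i j : Fin n)
    (h : StB G e f) :
    (i = ⟨n - 1, by omega⟩ ∧ j = ⟨n - 1, by omega⟩ ∧ StB _ (child G e i) (child G f j)) ∨
    (¬ (i = ⟨n - 1, by omega⟩ ∧ j = ⟨n - 1, by omega⟩) ∧
      StN _ (child G e i) (child G f j)) := by
  have hef : e ≠ f := fun h' => h.2.1 (by rw [h'])
  have h01 : ¬ 0 = n - 1 := by omega
  obtain ⟨h1, h2, h3, h4⟩ := h
  unfold StB StN
  simp only [ne_eq, ← (encV_inj G).eq_iff, encV_ini, encV_fin]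
  split_ifs <;> simp_all

theorem stN_step (G : GraphData (dendriteERS n hn)) (e f : G.E) (i j : Fin n)
    (h : StN G e f) : StN _ (child G e i) (child G f j) := by
  have hef : e ≠ f := fun h' => h.1 (by rw [h'])
  obtain ⟨h1, h2, h3, h4⟩ := h
  unfold StN
  simp only [ne_eq, ← (encV_inj G).eq_iff, encV_ini, encV_fin]
  split_ifs <;> simp_all

theorem noLoop_fullExp (m : ℕ) : NoLoop ((dendriteERS n hn).fullExp m) := by
  cases m with
  | zero => exact fun _ h => Bool.noConfusion h
  | succ m => exact noLoop_child _

theorem cast_val (p : (dendriteERS n hn).Alph) (c : (dendriteERS n hn).Col)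
    (h : p.1 = some c) :
    (cast (congrArg (dendriteERS n hn).E h) p.2 : (dendriteERS n hn).E (some c)) =
      dendriteVal n hn p := by
  rcases p with ⟨w, e⟩
  cases h
  rfl

theorem wordEdge_succ (x : ℕ → (dendriteERS n hn).Alph) (m : ℕ)
    (hx : (dendriteERS n hn).IsWalk x) :
    ((dendriteERS n hn).wordEdge x (m + 1) (hx.upTo (m + 1))).1 =
      child ((dendriteERS n hn).fullExp m) ((dendriteERS n hn).wordEdge x m (hx.upTo m)).1
        (dendriteVal n hn (x (m + 1))) := by
  have h : (x (m + 1)).1 = some (((dendriteERS n hn).fullExp m).col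
      ((dendriteERS n hn).wordEdge x m (hx.upTo m)).1) := hx.2 m
  have := cast_val (x (m + 1)) _ h
  change (⟨_, _⟩ : Sigma _) = ⟨_, _⟩
  exact congrArg _ this

theorem wordEdge_congr (x y : ℕ → (dendriteERS n hn).Alph)
    (hx : (dendriteERS n hn).IsWalk x) (hy : (dendriteERS n hn).IsWalk y) (m : ℕ)
    (h : ∀ l ≤ m, x l = y l) :
    ((dendriteERS n hn).wordEdge x m (hx.upTo m)).1 =
      ((dendriteERS n hn).wordEdge y m (hy.upTo m)).1 := by
  induction m with
  | zero => rfl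
  | succ m ih =>
    rw [wordEdge_succ x _ hx, wordEdge_succ y _ hy, ih (fun l hl => h l (by omega)), h (m + 1) le_rfl]

theorem val_inj (x y : ℕ → (dendriteERS n hn).Alph)
    (hx : (dendriteERS n hn).IsWalk x) (hy : (dendriteERS n hn).IsWalk y) (m : ℕ)
    (h : dendriteVal n hn (x (m + 1)) = dendriteVal n hn (y (m + 1))) :
    x (m + 1) = y (m + 1) := by
  have h1 : (x (m + 1)).1 = some PUnit.unit := hx.2 m
  have h2 : (y (m + 1)).1 = some PUnit.unit := hy.2 m
  generalize x (m + 1) = p at *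
  generalize y (m + 1) = q at *
  rcases p with ⟨w, e⟩
  rcases q with ⟨w', e'⟩
  cases h1
  cases h2
  exact congrArg (Sigma.mk _) h

theorem zero_eq (x y : ℕ → (dendriteERS n hn).Alph)
    (hx : (dendriteERS n hn).IsWalk x) (hy : (dendriteERS n hn).IsWalk y) :
    x 0 = y 0 := by
  have h1 := hx.1
  have h2 := hy.1
  generalize x 0 = p at *
  generalize y 0 = q at *
  rcases p with ⟨w, e⟩
  rcases q with ⟨w', e'⟩
  cases h1
  cases h2
  rfl

end Helpers

/-- In the dendrite replacement system `D_n`, two distinct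
sequences `α, β` are glued if and only if, after a common prefix (position `0`
carries the common base letter `S`, the prefix `p` occupies positions
`1, …, m-1`), they read two distinct letters `i ≠ j`, then both read the edge
`1` (encoded by `0 : Fin n`), and then both read the edge `n` (encoded by
`n - 1 : Fin n`) forever. -/
theorem dendrite_gluing_characterization (n : ℕ) (hn : 2 ≤ n)
    (x y : ℕ → (dendriteERS n hn).Alph)
    (hx : (dendriteERS n hn).IsWalk x) (hy : (dendriteERS n hn).IsWalk y)
    (hne : x ≠ y) :
    (dendriteERS n hn).Glued x y hx hy ↔
      ∃ m : ℕ, 1 ≤ m ∧ (∀ l < m, x l = y l) ∧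
        dendriteVal n hn (x m) ≠ dendriteVal n hn (y m) ∧
        dendriteVal n hn (x (m + 1)) = ⟨0, by omega⟩ ∧
        dendriteVal n hn (y (m + 1)) = ⟨0, by omega⟩ ∧
        ∀ l : ℕ, m + 1 < l →
          dendriteVal n hn (x l) = ⟨n - 1, by omega⟩ ∧
          dendriteVal n hn (y l) = ⟨n - 1, by omega⟩ := by
  classical
  have key : ∀ m : ℕ, (∀ l < m + 1, x l = y l) →
      dendriteVal n hn (x (m + 1)) ≠ dendriteVal n hn (y (m + 1)) →
      StA _ ((dendriteERS n hn).wordEdge x (m + 1) (hx.upTo (m + 1))).1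
        ((dendriteERS n hn).wordEdge y (m + 1) (hy.upTo (m + 1))).1 := by
    intro m h1 h2
    rw [wordEdge_succ x _ hx, wordEdge_succ y _ hy,
      wordEdge_congr x y hx hy m (fun l hl => h1 l (by omega))]
    exact stA_child _ (noLoop_fullExp m) _ _ _ h2
  constructor
  · rintro ⟨N, hN⟩
    have hnotN : ∀ k, ¬ StN _ ((dendriteERS n hn).wordEdge x k (hx.upTo k)).1
        ((dendriteERS n hn).wordEdge y k (hy.upTo k)).1 := by
      intro k hk
      have hall : ∀ d, StN _ ((dendriteERS n hn).wordEdge x (k + d) (hx.upTo (k + d))).1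
          ((dendriteERS n hn).wordEdge y (k + d) (hy.upTo (k + d))).1 := by
        intro d
        induction d with
        | zero => exact hk
        | succ d ih =>
          have := stN_step _ _ _ (dendriteVal n hn (x (k + d + 1)))
            (dendriteVal n hn (y (k + d + 1))) ih
          rw [← wordEdge_succ x _ hx, ← wordEdge_succ y _ hy] at this
          exact this
      exact (hall N).not_adj (hN (k + N) (by omega))
    have hex : ∃ l, x l ≠ y l := by
      by_contra! h
      exact hne (funext h)
    obtain ⟨m, hm, hmin⟩ : ∃ m, x m ≠ y m ∧ ∀ l < m, x l = y l :=
      ⟨Nat.find hex, Nat.find_spec hex, fun l hl => not_not.1 (Nat.find_min hex hl)⟩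
    obtain _ | m := m
    · exact absurd (zero_eq x y hx hy) hm
    have hv : dendriteVal n hn (x (m + 1)) ≠ dendriteVal n hn (y (m + 1)) :=
      fun h => hm (val_inj x y hx hy m h)
    have hA := key m hmin hv
    have hB := stA_step _ _ _ (dendriteVal n hn (x (m + 1 + 1)))
      (dendriteVal n hn (y (m + 1 + 1))) hA
    rw [← wordEdge_succ x _ hx, ← wordEdge_succ y _ hy] at hB
    rcases hB with ⟨hx0, hy0, hB⟩ | ⟨_, hB⟩
    swap
    · exact absurd hB (hnotN (m + 1 + 1))
    have hBall : ∀ d, StB _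
        ((dendriteERS n hn).wordEdge x (m + 1 + 1 + d) (hx.upTo (m + 1 + 1 + d))).1
        ((dendriteERS n hn).wordEdge y (m + 1 + 1 + d) (hy.upTo (m + 1 + 1 + d))).1 ∧
        (dendriteVal n hn (x (m + 1 + 1 + d + 1)) = ⟨n - 1, by omega⟩ ∧
          dendriteVal n hn (y (m + 1 + 1 + d + 1)) = ⟨n - 1, by omega⟩) := by
      have hstep : ∀ k, StB _ ((dendriteERS n hn).wordEdge x k (hx.upTo k)).1
        ((dendriteERS n hn).wordEdge y k (hy.upTo k)).1 →
        (dendriteVal n hn (x (k + 1)) = ⟨n - 1, by omega⟩ ∧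
          dendriteVal n hn (y (k + 1)) = ⟨n - 1, by omega⟩) ∧
        StB _ ((dendriteERS n hn).wordEdge x (k + 1) (hx.upTo (k + 1))).1
        ((dendriteERS n hn).wordEdge y (k + 1) (hy.upTo (k + 1))).1 := by
        intro k hk
        have hB := stB_step _ _ _ (dendriteVal n hn (x (k + 1)))
          (dendriteVal n hn (y (k + 1))) hk
        rw [← wordEdge_succ x _ hx, ← wordEdge_succ y _ hy] at hB
        rcases hB with ⟨h1, h2, hB⟩ | ⟨_, hB⟩
        · exact ⟨⟨h1, h2⟩, hB⟩
        · exact absurd hB (hnotN (k + 1))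
      intro d
      induction d with
      | zero => exact ⟨hB, (hstep (m + 1 + 1) hB).1⟩
      | succ d ih =>
        have h := (hstep _ ih.1).2
        exact ⟨h, (hstep _ h).1⟩
    refine ⟨m + 1, by omega, hmin, hv, hx0, hy0, ?_⟩
    intro l hl
    obtain ⟨d, rfl⟩ : ∃ d, l = m + 1 + 1 + d + 1 := ⟨l - (m + 3), by omega⟩
    exact (hBall d).2
  · rintro ⟨m, hm1, hmin, hv, hx0, hy0, hrest⟩
    obtain _ | m := m
    · omega
    have hA := key m hmin hv
    have hB := stA_step _ _ _ (dendriteVal n hn (x (m + 1 + 1)))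
      (dendriteVal n hn (y (m + 1 + 1))) hA
    rw [← wordEdge_succ x _ hx, ← wordEdge_succ y _ hy] at hB
    rcases hB with ⟨-, -, hB⟩ | ⟨h, _⟩
    swap
    · exact absurd ⟨hx0, hy0⟩ h
    have hBall : ∀ d, StB _
        ((dendriteERS n hn).wordEdge x (m + 1 + 1 + d) (hx.upTo (m + 1 + 1 + d))).1
        ((dendriteERS n hn).wordEdge y (m + 1 + 1 + d) (hy.upTo (m + 1 + 1 + d))).1 := by
      intro d
      induction d with
      | zero => exact hB
      | succ d ih =>
        have hB := stB_step _ _ _ (dendriteVal n hn (x (m + 1 + 1 + d + 1)))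
          (dendriteVal n hn (y (m + 1 + 1 + d + 1))) ih
        rw [← wordEdge_succ x _ hx, ← wordEdge_succ y _ hy] at hB
        rcases hB with ⟨_, _, hB⟩ | ⟨h, _⟩
        · exact hB
        · exact absurd (hrest _ (by omega)) h
    refine ⟨m + 1 + 1, fun k hk => ?_⟩
    obtain ⟨d, rfl⟩ : ∃ d, k = m + 1 + 1 + d := ⟨k - (m + 2), by omega⟩
    exact ⟨_, Or.inr rfl, Or.inr (hBall d).1.symm⟩

end ERSPaper
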